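/- (Robins, complete invariance of the integer point transform for finite sets) Let p_1 < p_2 < ⋯ < p_n be the first n prime numbers and set ξ* = (1/π)(√p_1, …, √p_n) ∈ ℝ^n. Then for any two finite subsets S_1, S_2 ⊂ ℤ^n: S_1 = S_2 if and only if Σ_{v ∈ S_1} e^{2πi ⟨v, ξ*⟩} = Σ_{v ∈ S_2} e^{2πi ⟨v, ξ*⟩}. -/

import Mathlib

open scoped Real
noncomputable section

/-- The special evaluation point `ξ* = (1/π)(√p₁, …, √p_n)`, where `p₁ < p₂ < ⋯` are the
primes (`Nat.nth Nat.Prime i` is the `(i+1)`-st prime, `Nat.nth Nat.Prime 0 = 2`). -/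
def xiStar (n : ℕ) : Fin n → ℝ :=
  fun i => Real.sqrt (Nat.nth Nat.Prime (i : ℕ)) / π

/-- The integer point transform of a finite set `S ⊆ ℤⁿ` evaluated at `ξ ∈ ℝⁿ`:
`σ_S(ξ) = Σ_{v ∈ S} e^{2πi⟨v, ξ⟩}`. -/
def intPointTransform {n : ℕ} (S : Finset (Fin n → ℤ)) (ξ : Fin n → ℝ) : ℂ :=
  ∑ v ∈ S, Complex.exp (2 * (π : ℂ) * Complex.I * ∑ i, (v i : ℂ) * (ξ i : ℂ))

/-- Adjoining to a real subfield the square root of one of its elements yields a subfield whose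
elements are linear polynomials in that square root. -/
theorem exists_subfield_sq_extension (K : Subfield ℝ) (x : ℝ) (hx : x ^ 2 ∈ K) :
    ∃ L : Subfield ℝ, K ≤ L ∧ x ∈ L ∧ ∀ y ∈ L, ∃ a ∈ K, ∃ b ∈ K, y = a + b * x := by
  by_cases hxK : x ∈ K
  · exact ⟨K, le_rfl, hxK, fun y hy => ⟨y, hy, 0, K.zero_mem, by simp⟩⟩
  refine ⟨{
    carrier := {y | ∃ a ∈ K, ∃ b ∈ K, y = a + b * x}
    mul_mem' := ?_
    one_mem' := ⟨1, K.one_mem, 0, K.zero_mem, by simp⟩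
    add_mem' := ?_
    zero_mem' := ⟨0, K.zero_mem, 0, K.zero_mem, by simp⟩
    neg_mem' := ?_
    inv_mem' := ?_ }, fun y hy => ⟨y, hy, 0, K.zero_mem, by simp⟩,
    ⟨0, K.zero_mem, 1, K.one_mem, by simp⟩, fun y hy => hy⟩
  · rintro _ _ ⟨a, ha, b, hb, rfl⟩ ⟨c, hc, d, hd, rfl⟩
    exact ⟨a * c + b * d * x ^ 2, K.add_mem (K.mul_mem ha hc) (K.mul_mem (K.mul_mem hb hd) hx),
      a * d + b * c,
      K.add_mem (K.mul_mem ha hd) (K.mul_mem hb hc), by ring⟩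
  · rintro _ _ ⟨a, ha, b, hb, rfl⟩ ⟨c, hc, d, hd, rfl⟩
    exact ⟨a + c, K.add_mem ha hc, b + d, K.add_mem hb hd, by ring⟩
  · rintro _ ⟨a, ha, b, hb, rfl⟩
    exact ⟨-a, K.neg_mem ha, -b, K.neg_mem hb, by ring⟩
  · rintro _ ⟨a, ha, b, hb, rfl⟩
    have hnorm : a ^ 2 - b ^ 2 * x ^ 2 ∈ K :=
      K.sub_mem (K.pow_mem ha 2) (K.mul_mem (K.pow_mem hb 2) hx)
    refine ⟨a / (a ^ 2 - b ^ 2 * x ^ 2), K.div_mem ha hnorm, -b / (a ^ 2 - b ^ 2 * x ^ 2),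
      K.div_mem (K.neg_mem hb) hnorm, ?_⟩
    by_cases hb0 : b = 0
    · subst hb0
      by_cases ha0 : a = 0
      · simp [ha0]
      · simp [sq, div_mul_cancel_left₀ ha0]
    · have h1 : a + b * x ≠ 0 := fun h => hxK <| by
        have : x = -a / b := by field_simp; linarith
        rw [this]
        exact K.div_mem (K.neg_mem ha) hb
      have h2 : a - b * x ≠ 0 := fun h => hxK <| by
        have : x = a / b := by field_simp; linarith
        rw [this]
        exact K.div_mem ha hb
      have h3 : a ^ 2 - b ^ 2 * x ^ 2 ≠ 0 := by
        have := mul_ne_zero h1 h2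
        contrapose! this
        linarith
      field_simp
      ring

theorem irrational_sqrt_of_squarefree {q : ℕ} (hq : 1 < q) (hsq : Squarefree q) :
    Irrational √(q : ℝ) := by
  rw [irrational_sqrt_natCast_iff]
  rintro ⟨r, rfl⟩
  have := Nat.isUnit_iff.1 (hsq r dvd_rfl)
  simp [this] at hq

/-- The field generated by the square roots of finitely many primes contains no square root of a
nontrivial squarefree number coprime to those primes. -/
theorem exists_subfield_sqrt_primes (T : Finset ℕ) (hT : ∀ p ∈ T, p.Prime) :
    ∃ K : Subfield ℝ, (∀ p ∈ T, √(p : ℝ) ∈ K) ∧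
      ∀ q : ℕ, 1 < q → Squarefree q → (∀ p ∈ T, ¬ p ∣ q) → √(q : ℝ) ∉ K := by
  induction T using Finset.induction with
  | empty =>
    refine ⟨(algebraMap ℚ ℝ).fieldRange, by simp, fun q hq hsq _ => ?_⟩
    exact irrational_sqrt_of_squarefree hq hsq
  | insert p T hpT ih =>
    obtain ⟨K, hK, hKq⟩ := ih fun r hr => hT r (Finset.mem_insert_of_mem hr)
    have hp : p.Prime := hT p (Finset.mem_insert_self p T)
    have hTp : ∀ r ∈ T, ¬ r ∣ p := fun r hr h =>
      hpT <| (Nat.prime_dvd_prime_iff_eq (hT r (Finset.mem_insert_of_mem hr)) hp).1 h ▸ hr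
    have hpsq : √(p : ℝ) ^ 2 = p := Real.sq_sqrt p.cast_nonneg
    obtain ⟨L, hKL, hpL, hL⟩ := exists_subfield_sq_extension K √(p : ℝ)
      (by rw [hpsq]; exact natCast_mem K p)
    refine ⟨L, fun r hr => ?_, fun q hq hsq hTq hmem => ?_⟩
    · rcases Finset.mem_insert.1 hr with rfl | hr
      · exact hpL
      · exact hKL (hK r hr)
    have hTq' : ∀ r ∈ T, ¬ r ∣ q := fun r hr => hTq r (Finset.mem_insert_of_mem hr)
    have hpq : ¬ p ∣ q := hTq p (Finset.mem_insert_self p T)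
    obtain ⟨a, ha, b, hb, hab⟩ := hL _ hmem
    have hqsq : √(q : ℝ) ^ 2 = q := Real.sq_sqrt q.cast_nonneg
    by_cases hb0 : b = 0
    · refine hKq q hq hsq hTq' ?_
      rw [hab, hb0]
      simpa using ha
    by_cases ha0 : a = 0
    · refine hKq (q * p) (hq.trans_le (Nat.le_mul_of_pos_right q hp.pos)) ?_ ?_ ?_
      · exact (Nat.squarefree_mul ((Nat.Prime.coprime_iff_not_dvd hp).2 hpq).symm).2
          ⟨hsq, hp.prime.squarefree⟩
      · intro r hr h
        rcases (Nat.Prime.dvd_mul (hT r (Finset.mem_insert_of_mem hr))).1 h with h | h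
        · exact hTq' r hr h
        · exact hTp r hr h
      · have : √((q * p : ℕ) : ℝ) = b * p := by
          rw [Nat.cast_mul, Real.sqrt_mul q.cast_nonneg, hab, ha0, zero_add, mul_assoc, ← sq, hpsq]
        rw [this]
        exact K.mul_mem hb (natCast_mem K p)
    · refine hKq p hp.one_lt hp.prime.squarefree hTp ?_
      have : √(p : ℝ) = (q - a ^ 2 - b ^ 2 * p) / (2 * a * b) := by
        rw [eq_div_iff (by positivity), ← hqsq, hab]
        linear_combination (-b ^ 2) * hpsq
      rw [this]
      refine K.div_mem (K.sub_mem (K.sub_mem (natCast_mem K q) (K.pow_mem ha 2))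
        (K.mul_mem (K.pow_mem hb 2) (natCast_mem K p))) (K.mul_mem (K.mul_mem ?_ ha) hb)
      exact ofNat_mem K 2

/-- Square roots of distinct primes are linearly independent over `ℤ`. -/
theorem linearIndependent_sqrt_primes {ι : Type*} [Fintype ι] {p : ι → ℕ}
    (hp : ∀ i, (p i).Prime) (hinj : Function.Injective p) {v : ι → ℤ}
    (hv : ∑ i, (v i : ℝ) * √(p i : ℝ) = 0) : v = 0 := by
  classical
  by_contra hne
  obtain ⟨j, hj⟩ := Function.ne_iff.1 hne
  obtain ⟨K, hK, hKq⟩ := exists_subfield_sqrt_primes ((Finset.univ.erase j).image p)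
    (by simp only [Finset.mem_image]; rintro _ ⟨i, -, rfl⟩; exact hp i)
  refine hKq (p j) (hp j).one_lt (hp j).prime.squarefree ?_ ?_
  · simp only [Finset.mem_image]
    rintro _ ⟨i, hi, rfl⟩ h
    exact Finset.ne_of_mem_erase hi (hinj ((Nat.prime_dvd_prime_iff_eq (hp i) (hp j)).1 h))
  · have hvj : (v j : ℝ) ≠ 0 := Int.cast_ne_zero.2 hj
    have : √(p j : ℝ) = -(∑ i ∈ Finset.univ.erase j, (v i : ℝ) * √(p i : ℝ)) / v j := by
      rw [← Finset.add_sum_erase _ _ (Finset.mem_univ j)] at hv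
      rw [eq_div_iff hvj]
      linarith
    rw [this]
    exact K.div_mem (K.neg_mem (K.sum_mem fun i hi => K.mul_mem (intCast_mem K _)
      (hK _ (Finset.mem_image_of_mem p hi)))) (intCast_mem K _)

open Polynomial in
/-- If the weighted power sums of nonzero algebraic numbers `β i` with integer weights `G i` are
all integers, then `∑ G i * exp (β i)` is not a nonzero integer. -/
theorem intCast_add_sum_exp_ne_zero {ι : Type*} (s : Finset ι) (G : ι → ℤ) (β : ι → ℂ)
    (hβ : ∀ i ∈ s, β i ≠ 0) (halg : ∀ i ∈ s, IsAlgebraic ℤ (β i))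
    (hint : ∀ g : ℤ[X], ∃ M : ℤ, ∑ i ∈ s, (G i : ℂ) * aeval (β i) g = M)
    {a : ℤ} (ha : a ≠ 0) : (a : ℂ) + ∑ i ∈ s, (G i : ℂ) * Complex.exp (β i) ≠ 0 := by
  intro hsum
  have hq : ∀ i, ∃ q : ℤ[X], i ∈ s → q.coeff 0 ≠ 0 ∧ aeval (β i) q = 0 := fun i => by
    by_cases hi : i ∈ s
    · obtain ⟨q, hq⟩ := (halg i hi).exists_nonzero_coeff_and_aeval_eq_zero
        (mem_nonZeroDivisors_of_ne_zero (hβ i hi))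
      exact ⟨q, fun _ => hq⟩
    · exact ⟨0, fun h => absurd h hi⟩
  choose q hq using hq
  set f : ℤ[X] := ∏ i ∈ s, q i with hf
  have hf0 : f.eval 0 ≠ 0 := by
    rw [hf, eval_prod, Finset.prod_ne_zero_iff]
    intro i hi
    rw [← coeff_zero_eq_eval_zero]
    exact (hq i hi).1
  have hfne : f ≠ 0 := fun h => hf0 (by simp [h])
  have hroot : ∀ i ∈ s, β i ∈ f.aroots ℂ := fun i hi => by
    rw [mem_aroots]
    exact ⟨hfne, by rw [hf, map_prod]; exact Finset.prod_eq_zero hi (hq i hi).2⟩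
  obtain ⟨c, hc⟩ := LindemannWeierstrass.exp_polynomial_approx f hf0
  have hlim : Filter.Tendsto
      (fun p : ℕ => (∑ i ∈ s, |(G i : ℝ)|) * (c * (c ^ (p - 1) / (p - 1).factorial)))
      Filter.atTop (nhds 0) := by
    have := ((FloorSemiring.tendsto_pow_div_factorial_atTop c).comp
      (Filter.tendsto_sub_atTop_nat 1)).const_mul c |>.const_mul (∑ i ∈ s, |(G i : ℝ)|)
    simpa using this
  obtain ⟨N, hN⟩ := Filter.eventually_atTop.1 (hlim.eventually_lt_const one_pos)
  obtain ⟨p, hpN, hp⟩ := Nat.exists_infinite_primes (N + (f.eval 0).natAbs + a.natAbs + 1)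
  obtain ⟨m, hm, g, -, hg⟩ := hc p (by omega) hp
  obtain ⟨M, hM⟩ := hint g
  have hkey : ((m * a + p * M : ℤ) : ℂ) =
      -∑ i ∈ s, (G i : ℂ) * (m • Complex.exp (β i) - p • aeval (β i) g) := by
    have h1 : ∑ i ∈ s, (G i : ℂ) * (m • Complex.exp (β i) - p • aeval (β i) g) =
        m * ∑ i ∈ s, (G i : ℂ) * Complex.exp (β i) -
          p * ∑ i ∈ s, (G i : ℂ) * aeval (β i) g := by
      rw [Finset.mul_sum, Finset.mul_sum, ← Finset.sum_sub_distrib]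
      refine Finset.sum_congr rfl fun i _ => ?_
      simp only [zsmul_eq_mul, nsmul_eq_mul]
      ring
    rw [h1, hM]
    push_cast
    linear_combination (m : ℂ) * hsum
  have hlt : ‖((m * a + p * M : ℤ) : ℂ)‖ < 1 := by
    rw [hkey, norm_neg]
    refine (norm_sum_le _ _).trans_lt (lt_of_le_of_lt ?_ (hN p (by omega)))
    rw [Finset.sum_mul]
    refine Finset.sum_le_sum fun i hi => ?_
    rw [norm_mul, Complex.norm_intCast]
    refine mul_le_mul_of_nonneg_left ((hg (hroot i hi)).trans_eq ?_) (abs_nonneg _)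
    rw [← mul_div_assoc, ← pow_succ', Nat.sub_add_cancel hp.one_le]
  have hzero : m * a + p * M = 0 := by
    rw [Complex.norm_intCast] at hlt
    exact Int.abs_lt_one_iff.1 (by exact_mod_cast hlt)
  have hdvd : (p : ℤ) ∣ m * a := ⟨-M, by linarith⟩
  rcases Int.Prime.dvd_mul' hp hdvd with h | h
  · exact hm h
  · have := Int.le_of_dvd (abs_pos.2 ha) ((dvd_abs _ _).2 h)
    rw [Int.abs_eq_natAbs] at this
    omega

/-- The coordinatewise sign change of `ℤ^ι` given by a vector of signs. -/
def signChange {ι : Type*} (ε : ι → ℤˣ) : (ι → ℤ) ≃+ (ι → ℤ) :=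
  AddEquiv.piCongrRight fun i => DistribMulAction.toAddEquiv ℤ (ε i)

theorem signChange_apply {ι : Type*} (ε : ι → ℤˣ) (v : ι → ℤ) (i : ι) :
    signChange ε v i = ε i * v i := rfl

/-- A weighted sum of monomials with an odd exponent vanishes if the weights are invariant under
sign changes. -/
theorem sum_mul_prod_pow_eq_zero {ι : Type*} [Fintype ι] (G : (ι → ℤ) →₀ ℤ)
    (hG : ∀ ε v, G (signChange ε v) = G v) (e : ι → ℕ) {j : ι} (hj : Odd (e j)) :
    ∑ v ∈ G.support, G v * ∏ i, v i ^ e i = 0 := by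
  classical
  set ε : ι → ℤˣ := Function.update 1 j (-1) with hε
  have hprod : ∀ v : ι → ℤ, ∏ i, signChange ε v i ^ e i = -∏ i, v i ^ e i := fun v => by
    rw [← Finset.mul_prod_erase _ _ (Finset.mem_univ j),
      ← Finset.mul_prod_erase _ (fun i => v i ^ e i) (Finset.mem_univ j), ← neg_mul]
    congr 1
    · simp [signChange_apply, hε, hj.neg_pow]
    · refine Finset.prod_congr rfl fun i hi => ?_
      simp [signChange_apply, hε, Function.update_of_ne (Finset.ne_of_mem_erase hi)]
  have h : ∑ v ∈ G.support, G v * ∏ i, v i ^ e i =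
      ∑ v ∈ G.support, -(G v * ∏ i, v i ^ e i) :=
    (Finset.sum_equiv (signChange ε).toEquiv (by simp [hG]) fun v _ => by
      simp [hG, hprod]).symm
  rw [Finset.sum_neg_distrib] at h
  omega

/-- Power sums of integer linear combinations of square roots of integers are integers if the
weights are invariant under sign changes. -/
theorem exists_int_sum_mul_pow {ι : Type*} [Fintype ι] (G : (ι → ℤ) →₀ ℤ)
    (hG : ∀ ε v, G (signChange ε v) = G v) (x : ι → ℂ) (c : ι → ℤ) (hx : ∀ i, x i ^ 2 = c i)
    (k : ℕ) : ∃ M : ℤ, ∑ v ∈ G.support, (G v : ℂ) * (∑ i, (v i : ℂ) * x i) ^ k = M := by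
  classical
  have hexp : ∑ v ∈ G.support, (G v : ℂ) * (∑ i, (v i : ℂ) * x i) ^ k =
      ∑ e ∈ Finset.univ.piAntidiag k, (Nat.multinomial Finset.univ e : ℂ) *
        ((∑ v ∈ G.support, G v * ∏ i, v i ^ e i : ℤ) * ∏ i, x i ^ e i) := by
    simp_rw [Finset.sum_pow_eq_sum_piAntidiag, mul_pow, Finset.prod_mul_distrib, Finset.mul_sum]
    rw [Finset.sum_comm]
    refine Finset.sum_congr rfl fun e _ => ?_
    push_cast
    rw [Finset.sum_mul, Finset.mul_sum]
    exact Finset.sum_congr rfl fun v _ => by ring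
  rw [hexp]
  have hterm : ∀ e : ι → ℕ, ∃ M : ℤ, (Nat.multinomial Finset.univ e : ℂ) *
      ((∑ v ∈ G.support, G v * ∏ i, v i ^ e i : ℤ) * ∏ i, x i ^ e i) = M := fun e => by
    by_cases he : ∃ j, Odd (e j)
    · obtain ⟨j, hj⟩ := he
      exact ⟨0, by rw [sum_mul_prod_pow_eq_zero G hG e hj]; simp⟩
    · refine ⟨Nat.multinomial Finset.univ e *
        ((∑ v ∈ G.support, G v * ∏ i, v i ^ e i) * ∏ i, c i ^ (e i / 2)), ?_⟩
      have : ∏ i, x i ^ e i = ∏ i, (c i : ℂ) ^ (e i / 2) := Finset.prod_congr rfl fun i _ => by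
        rw [← hx, ← pow_mul, Nat.two_mul_div_two_of_even]
        exact Nat.not_odd_iff_even.1 fun h => he ⟨i, h⟩
      rw [this]
      push_cast
      rfl
  choose M hM using hterm
  exact ⟨∑ e ∈ Finset.univ.piAntidiag k, M e, by
    rw [Int.cast_sum]; exact Finset.sum_congr rfl fun e _ => hM e⟩

open Polynomial in
theorem exists_int_sum_mul_aeval {ι : Type*} [Fintype ι] (G : (ι → ℤ) →₀ ℤ)
    (hG : ∀ ε v, G (signChange ε v) = G v) (x : ι → ℂ) (c : ι → ℤ) (hx : ∀ i, x i ^ 2 = c i)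
    (g : ℤ[X]) : ∃ M : ℤ, ∑ v ∈ G.support, (G v : ℂ) * aeval (∑ i, (v i : ℂ) * x i) g = M := by
  choose M hM using exists_int_sum_mul_pow G hG x c hx
  refine ⟨∑ k ∈ Finset.range (g.natDegree + 1), g.coeff k * M k, ?_⟩
  simp_rw [aeval_eq_sum_range, Finset.mul_sum]
  rw [Finset.sum_comm]
  push_cast
  refine Finset.sum_congr rfl fun k _ => ?_
  rw [← hM, Finset.mul_sum]
  exact Finset.sum_congr rfl fun v _ => by rw [zsmul_eq_mul]; ring

/-- Every nonzero element of the group ring `ℤ[ℤ^ι]` divides one that is invariant under sign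
changes and has a nonzero constant coefficient. -/
theorem exists_dvd_signChange_invariant {ι : Type*} [Fintype ι]
    {F : AddMonoidAlgebra ℤ (ι → ℤ)} (hF : F ≠ 0) :
    ∃ G : AddMonoidAlgebra ℤ (ι → ℤ), F ∣ G ∧
      (∀ ε v, G.coeff (signChange ε v) = G.coeff v) ∧ G.coeff 0 ≠ 0 := by
  classical
  let act (ε : ι → ℤˣ) := AddMonoidAlgebra.mapDomainRingEquiv ℤ (signChange ε)
  have hcoeff : ∀ ε x v, (act ε x).coeff (signChange ε v) = x.coeff v := fun ε x v => by
    rw [AddMonoidAlgebra.coeff_mapDomainRingEquiv, Finsupp.equivMapDomain_apply]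
    exact congrArg _ ((signChange ε).symm_apply_apply v)
  have hcomp : ∀ ε δ x, act ε (act δ x) = act (ε * δ) x := fun ε δ x => by
    refine AddMonoidAlgebra.coeff_injective (Finsupp.ext fun v => ?_)
    obtain ⟨w, rfl⟩ := (signChange (ε * δ)).surjective v
    rw [hcoeff]
    have : signChange (ε * δ) w = signChange ε (signChange δ w) := by
      ext i
      simp [signChange_apply, mul_assoc]
    rw [this, hcoeff, hcoeff]
  set H := ∏ ε, act ε F with hH
  have hH0 : H ≠ 0 := Finset.prod_ne_zero_iff.2 fun ε _ => by simpa using hF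
  have hHact : ∀ ε, act ε H = H := fun ε => by
    rw [hH, map_prod]
    simp_rw [hcomp]
    exact Fintype.prod_equiv (Equiv.mulLeft ε) _ _ fun δ => rfl
  have hFH : F ∣ H := by
    have h1 : act 1 F = F := by
      refine AddMonoidAlgebra.coeff_injective (Finsupp.ext fun v => ?_)
      have : signChange 1 v = v := by ext i; simp [signChange_apply]
      rw [← hcoeff 1 F v, this]
    rw [← h1]
    exact Finset.dvd_prod_of_mem _ (Finset.mem_univ _)
  refine ⟨H * H, hFH.mul_right H, fun ε v => ?_, ?_⟩
  · rw [← hcoeff ε (H * H) v, map_mul, hHact]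
  · have hneg : ∀ v, H.coeff (-v) = H.coeff v := fun v => by
      have : signChange (-1) v = -v := by ext i; simp [signChange_apply]
      rw [← hcoeff (-1) H v, hHact, this]
    have hsum : (H * H).coeff 0 = ∑ v ∈ H.coeff.support, H.coeff v ^ 2 := by
      rw [AddMonoidAlgebra.coeff_mul]
      refine Finset.sum_congr rfl fun v hv => ?_
      dsimp only [Finsupp.sum]
      rw [Finset.sum_eq_single (-v)]
      · simp [hneg, sq]
      · intro w _ hw
        rw [if_neg fun h => hw (eq_neg_of_add_eq_zero_right h)]
      · intro h
        simp [hneg] at h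
        simp [hneg, h]
    rw [hsum]
    obtain ⟨v, hv⟩ := Finsupp.support_nonempty_iff.2
      (fun h => hH0 (AddMonoidAlgebra.coeff_eq_zero.1 h))
    exact (Finset.sum_pos (fun v hv => sq_pos_of_ne_zero (Finsupp.mem_support_iff.1 hv))
      ⟨v, hv⟩).ne'

/-- The evaluation homomorphism from the group ring `ℤ[ℤ^ι]` to `ℂ` that sends the basis vector at
`v` to `exp (∑ i, v i * x i)`. -/
def expEval {ι : Type*} [Fintype ι] (x : ι → ℂ) : AddMonoidAlgebra ℤ (ι → ℤ) →ₐ[ℤ] ℂ :=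
  AddMonoidAlgebra.lift ℤ ℂ (ι → ℤ)
    { toFun := fun v => Complex.exp (∑ i, (v.toAdd i : ℂ) * x i)
      map_one' := by simp
      map_mul' := fun v w => by simp [← Complex.exp_add, ← Finset.sum_add_distrib, add_mul] }

theorem expEval_apply {ι : Type*} [Fintype ι] (x : ι → ℂ) (F : AddMonoidAlgebra ℤ (ι → ℤ)) :
    expEval x F = ∑ v ∈ F.coeff.support,
      (F.coeff v : ℂ) * Complex.exp (∑ i, (v i : ℂ) * x i) := by
  simp [expEval, AddMonoidAlgebra.lift_apply, Finsupp.sum]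

/-- If `x` is a family of square roots of integers that is linearly independent over `ℤ`, then the
exponentials of distinct integer combinations of `x` are linearly independent over `ℤ`. -/
theorem expEval_ne_zero {ι : Type*} [Fintype ι] (x : ι → ℂ) (c : ι → ℤ)
    (hx : ∀ i, x i ^ 2 = c i) (hli : ∀ v : ι → ℤ, ∑ i, (v i : ℂ) * x i = 0 → v = 0)
    {F : AddMonoidAlgebra ℤ (ι → ℤ)} (hF : F ≠ 0) : expEval x F ≠ 0 := by
  classical
  intro hzero
  obtain ⟨G, hFG, hG, hG0⟩ := exists_dvd_signChange_invariant hF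
  have hGzero : expEval x G = 0 := zero_dvd_iff.1 (hzero ▸ map_dvd (expEval x) hFG)
  have hmem : (0 : ι → ℤ) ∈ G.coeff.support := Finsupp.mem_support_iff.2 hG0
  rw [expEval_apply, ← Finset.add_sum_erase _ _ hmem] at hGzero
  refine intCast_add_sum_exp_ne_zero (G.coeff.support.erase 0) G.coeff
    (fun v => ∑ i, (v i : ℂ) * x i) (fun v hv h => Finset.ne_of_mem_erase hv (hli v h))
    (fun v _ => ?_) (fun g => ?_) hG0 (by simpa using hGzero)
  · refine (IsIntegral.sum _ fun i _ => ?_).isAlgebraic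
    refine (isIntegral_algebraMap (R := ℤ) (x := v i)).mul (IsIntegral.of_pow two_pos ?_)
    rw [hx i]
    exact isIntegral_algebraMap (R := ℤ) (x := c i)
  · obtain ⟨M, hM⟩ := exists_int_sum_mul_aeval G.coeff hG x c hx g
    refine ⟨M - G.coeff 0 * g.coeff 0, ?_⟩
    rw [← Finset.add_sum_erase _ _ hmem] at hM
    push_cast
    rw [← hM]
    have h0 : Polynomial.aeval (0 : ℂ) g = g.coeff 0 := by
      simpa using (Polynomial.coeff_zero_eq_aeval_zero' (A := ℂ) g).symm
    simp [h0]

/-- (Robins) The integer point transform evaluated at `ξ* = (1/π)(√p₁, …, √p_n)` is a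
complete invariant of finite subsets of `ℤⁿ`: two finite sets `S₁, S₂ ⊆ ℤⁿ` are equal iff
`σ_{S₁}(ξ*) = σ_{S₂}(ξ*)`. -/
theorem intPointTransform_complete_invariant (n : ℕ) (S₁ S₂ : Finset (Fin n → ℤ)) :
    S₁ = S₂ ↔ intPointTransform S₁ (xiStar n) = intPointTransform S₂ (xiStar n) := by
  refine ⟨fun h => h ▸ rfl, fun h => ?_⟩
  classical
  set p : Fin n → ℕ := fun i => Nat.nth Nat.Prime i with hp
  set x : Fin n → ℂ := fun i => 2 * Complex.I * (√(p i : ℝ) : ℝ) with hx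
  set ind : Finset (Fin n → ℤ) → AddMonoidAlgebra ℤ (Fin n → ℤ) :=
    fun S => ∑ v ∈ S, AddMonoidAlgebra.single v 1 with hind
  have hcoeff : ∀ S v, (ind S).coeff v = if v ∈ S then 1 else 0 := fun S v => by
    simp [hind, AddMonoidAlgebra.coeff_sum, Finsupp.finsetSum_apply, Finsupp.single_apply]
  have heval : ∀ S, expEval x (ind S) = intPointTransform S (xiStar n) := fun S => by
    rw [hind, map_sum, intPointTransform]
    refine Finset.sum_congr rfl fun v _ => ?_
    have hπ : (π : ℂ) ≠ 0 := Complex.ofReal_ne_zero.2 Real.pi_ne_zero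
    have : 2 * (π : ℂ) * Complex.I * ∑ i, (v i : ℂ) * (xiStar n i : ℂ) =
        ∑ i, (v i : ℂ) * x i := by
      rw [Finset.mul_sum]
      refine Finset.sum_congr rfl fun i _ => ?_
      simp only [xiStar, hx, hp, Complex.ofReal_div]
      field_simp
    rw [this]
    simp [expEval, AddMonoidAlgebra.lift_single]
  by_contra hne
  refine expEval_ne_zero x (fun i => -4 * p i) (fun i => ?_) (fun v hv => ?_)
    (F := ind S₁ - ind S₂) (fun h0 => hne ?_) (by rw [map_sub, heval, heval, h, sub_self])
  · have : ((√(p i : ℝ) : ℝ) : ℂ) ^ 2 = p i := by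
      rw [← Complex.ofReal_pow, Real.sq_sqrt (Nat.cast_nonneg _), Complex.ofReal_natCast]
    rw [hx, mul_pow, mul_pow, this, Complex.I_sq]
    push_cast
    ring
  · refine linearIndependent_sqrt_primes (fun i => Nat.prime_nth_prime i)
      ((Nat.nth_injective Nat.infinite_setOfPred_prime).comp Fin.val_injective) (p := p) ?_
    have : ∑ i, (v i : ℂ) * x i =
        2 * Complex.I * ((∑ i, (v i : ℝ) * √(p i : ℝ) : ℝ) : ℂ) := by
      push_cast
      rw [Finset.mul_sum]
      exact Finset.sum_congr rfl fun i _ => by rw [hx]; ring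
    rw [this] at hv
    exact Complex.ofReal_eq_zero.1
      ((mul_eq_zero.1 hv).resolve_left (mul_ne_zero two_ne_zero Complex.I_ne_zero))
  · ext v
    have := congrArg (fun F => F.coeff v) (sub_eq_zero.1 h0)
    simp only [hcoeff] at this
    by_cases h1 : v ∈ S₁ <;> by_cases h2 : v ∈ S₂ <;> simp_all
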